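/- For all nonnegative integers n and k and every real number z, ĉ_{n,k}(z) = Σ_{m=0}^{n} (−1)^m · C(n,m) · ĉ_{n−m,k} · (z)_m, where C(n,m) denotes the binomial coefficient and (z)_m = z(z−1)⋯(z−m+1) is the falling factorial (with (z)_0 = 1). -/

import Mathlib

/-- Unsigned Stirling numbers of the first kind:
`c(0,0)=1`, `c(n,m)=0` for `m>n` or (`n>0` and `m=0`), and `c(n+1,m)=n*c(n,m)+c(n,m-1)`. -/
def stirling1 : ℕ → ℕ → ℕ
  | 0, 0 => 1
  | 0, _ + 1 => 0
  | _ + 1, 0 => 0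
  | n + 1, m + 1 => n * stirling1 n (m + 1) + stirling1 n m

/-- Stirling numbers of the second kind:
`S(0,0)=1`, `S(n,m)=0` for `m>n` or (`n>0` and `m=0`), and `S(n+1,m)=m*S(n,m)+S(n,m-1)`. -/
def stirling2 : ℕ → ℕ → ℕ
  | 0, 0 => 1
  | 0, _ + 1 => 0
  | _ + 1, 0 => 0
  | n + 1, m + 1 => (m + 1) * stirling2 n (m + 1) + stirling2 n m

/-- Poly-Cauchy numbers of the second kind (negated upper index, unsigned):
`ĉ_{n,k} = Σ_{m=0}^n c(n,m)·(m+1)^k`. -/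
def polyCauchy (n k : ℕ) : ℕ := ∑ m ∈ Finset.range (n + 1), stirling1 n m * (m + 1) ^ k

/-- Poly-Cauchy polynomial (of the second kind, negated upper index, unsigned):
`ĉ_{n,k}(z) = Σ_{m=0}^n c(n,m) · Σ_{i=0}^m C(m,i)·(−1)^i·(m−i+1)^k·z^i`. -/
def polyCauchyPoly (n k : ℕ) (z : ℝ) : ℝ :=
  ∑ m ∈ Finset.range (n + 1), (stirling1 n m : ℝ) *
    ∑ i ∈ Finset.range (m + 1),
      (Nat.choose m i : ℝ) * (-1) ^ i * ((m - i + 1 : ℕ) : ℝ) ^ k * z ^ i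

/-- Falling factorial `(z)_m = z(z−1)⋯(z−m+1)` of a real number. -/
def fallFact (z : ℝ) (m : ℕ) : ℝ := ∏ j ∈ Finset.range m, (z - j)

theorem stirling1_eq_zero_of_lt : ∀ {n m : ℕ}, n < m → stirling1 n m = 0
  | 0, _ + 1, _ => by simp [stirling1]
  | n + 1, m + 1, h => by
    simp [stirling1, stirling1_eq_zero_of_lt (show n < m + 1 by omega),
      stirling1_eq_zero_of_lt (show n < m by omega)]

theorem sum_stirling1_mul_pow {R : Type*} [CommRing R] (n : ℕ) (x : R) :
    ∑ m ∈ Finset.range (n + 1), (stirling1 n m : R) * x ^ m =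
      ∏ j ∈ Finset.range n, (x + j) := by
  induction n with
  | zero => simp [stirling1]
  | succ n ih =>
    have shift : ∑ m ∈ Finset.range (n + 1), (n : R) * stirling1 n (m + 1) * x ^ (m + 1) =
        n * ∑ m ∈ Finset.range (n + 1), (stirling1 n m : R) * x ^ m := by
      rw [Finset.sum_range_succ, stirling1_eq_zero_of_lt (Nat.lt_succ_self n),
        Finset.sum_range_succ' _ n, mul_add, Finset.mul_sum]
      cases n <;> simp [stirling1, mul_assoc]
    rw [Finset.sum_range_succ', Finset.prod_range_succ, ← ih, mul_add, mul_comm _ (n : R),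
      ← shift, Finset.sum_mul, ← Finset.sum_add_distrib]
    simp only [stirling1, Nat.cast_zero, zero_mul, add_zero]
    refine Finset.sum_congr rfl fun m _ => ?_
    push_cast
    ring

theorem prod_range_add_add_natCast {R : Type*} [CommRing R] (n : ℕ) (x y : R) :
    ∏ j ∈ Finset.range n, (x + y + j) = ∑ ij ∈ Finset.HasAntidiagonal.antidiagonal n,
      (n.choose ij.1 : R) *
        ((∏ j ∈ Finset.range ij.1, (x + j)) * ∏ j ∈ Finset.range ij.2, (y + j)) := by
  induction n with
  | zero => simp
  | succ n ih =>
    rw [Finset.sum_antidiagonal_choose_succ_mul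
      (fun i k => (∏ j ∈ Finset.range i, (x + j)) * ∏ j ∈ Finset.range k, (y + j)),
      Finset.prod_range_succ, ih, Finset.sum_mul, ← Finset.sum_add_distrib]
    refine Finset.sum_congr rfl fun ij h => ?_
    have h' : ij.1 + ij.2 = n := Finset.HasAntidiagonal.mem_antidiagonal.mp h
    rw [Nat.choose_symm_of_eq_add h'.symm, Finset.prod_range_succ, Finset.prod_range_succ, ← h']
    push_cast
    ring

theorem prod_range_neg_add_eq_fallFact (z : ℝ) (m : ℕ) :
    ∏ j ∈ Finset.range m, (-z + j) = (-1) ^ m * fallFact z m := by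
  induction m with
  | zero => simp [fallFact]
  | succ m ih =>
    rw [fallFact, Finset.prod_range_succ, ih, Finset.prod_range_succ, ← fallFact]
    ring

open Polynomial in
/-- The linear functional on real polynomials sending `X ^ j` to `(j + 1) ^ k`. -/
noncomputable def powFunctional (k : ℕ) : ℝ[X] →ₗ[ℝ] ℝ :=
  Polynomial.lsum fun j => ((j : ℝ) + 1) ^ k • LinearMap.id

open Polynomial in
theorem powFunctional_X_pow (k j : ℕ) :
    powFunctional k (X ^ j) = ((j : ℝ) + 1) ^ k := by
  rw [powFunctional, Polynomial.lsum_apply, X_pow_eq_monomial, Polynomial.sum_monomial_index] <;>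
    simp

open Polynomial in
theorem powFunctional_C_mul (k : ℕ) (a : ℝ) (p : ℝ[X]) :
    powFunctional k (C a * p) = a * powFunctional k p := by
  rw [C_mul', map_smul, smul_eq_mul]

open Polynomial in
theorem powFunctional_natCast_mul (k a : ℕ) (p : ℝ[X]) :
    powFunctional k ((a : ℝ[X]) * p) = a * powFunctional k p := by
  rw [← C_eq_natCast, powFunctional_C_mul]

open Polynomial in
theorem powFunctional_prod_X_add (n k : ℕ) :
    powFunctional k (∏ j ∈ Finset.range n, ((X : ℝ[X]) + j)) = polyCauchy n k := by
  rw [← sum_stirling1_mul_pow, map_sum, polyCauchy]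
  simp [powFunctional_natCast_mul, powFunctional_X_pow]

open Polynomial in
theorem powFunctional_prod_X_add_C_neg_add (n k : ℕ) (z : ℝ) :
    powFunctional k (∏ j ∈ Finset.range n, ((X : ℝ[X]) + C (-z) + j)) = polyCauchyPoly n k z := by
  rw [← sum_stirling1_mul_pow, map_sum, polyCauchyPoly]
  refine Finset.sum_congr rfl fun m _ => ?_
  rw [powFunctional_natCast_mul, add_comm, add_pow, map_sum]
  congr 1
  refine Finset.sum_congr rfl fun i _ => ?_
  rw [← C_pow, mul_assoc, powFunctional_C_mul, mul_comm (X ^ _), powFunctional_natCast_mul,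
    powFunctional_X_pow, neg_pow]
  push_cast
  ring

theorem polyCauchyPoly_eq_sum (n k : ℕ) (z : ℝ) :
    polyCauchyPoly n k z = ∑ m ∈ Finset.range (n + 1),
      (-1 : ℝ) ^ m * (Nat.choose n m : ℝ) * (polyCauchy (n - m) k : ℝ) * fallFact z m := by
  rw [← powFunctional_prod_X_add_C_neg_add, add_comm, prod_range_add_add_natCast,
    Finset.Nat.sum_antidiagonal_eq_sum_range_succ_mk, map_sum]
  refine Finset.sum_congr rfl fun m _ => ?_
  have hC : ∏ j ∈ Finset.range m, (Polynomial.C (-z) + (j : Polynomial ℝ)) =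
      Polynomial.C ((-1) ^ m * fallFact z m) := by
    rw [← prod_range_neg_add_eq_fallFact, map_prod]
    simp
  rw [powFunctional_natCast_mul, hC, powFunctional_C_mul, powFunctional_prod_X_add]
  ring
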